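/- (Theorem 1, exact best-response form) Let M be a multi-agent MDP with n agents such that for every agent i and every fixed π_{-i} the projection Π_i(M,π_{-i}) has a unique optimal policy. Define a sequence of joint policies by choosing any π^0 and setting π^g := BR_{(g mod n)+1}(π^{g-1}) for g ≥ 1. Then for every state s the sequence g ↦ V^{M,π^g}(s) is non-decreasing, and there exists N ∈ ℕ such that π^g = π^N for all g ≥ N and π^N is a Nash equilibrium. -/

import Mathlib

open scoped ENNReal

/-- A (finite) Markov Decision Process with states `S`, actions `A`,
transition kernel `T`, reward `R` and discount factor `γ ∈ [0,1)`. -/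
structure MDP (S A : Type) [Fintype S] [Nonempty S] [Fintype A] [Nonempty A] where
  T : S → A → PMF S
  R : S → A → ℝ
  γ : ℝ
  γ_nonneg : 0 ≤ γ
  γ_lt_one : γ < 1

namespace MDP

variable {S A : Type} [Fintype S] [Nonempty S] [Fintype A] [Nonempty A]

/-- The distribution of the state at time `t` of the Markov chain induced by
policy `π`, started at `s₀`. -/
noncomputable def stateDist (M : MDP S A) (π : S → A) (s₀ : S) : ℕ → PMF S
  | 0 => PMF.pure s₀
  | t + 1 => (M.stateDist π s₀ t).bind fun s => M.T s (π s)

/-- The value of policy `π` at state `s₀`: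
`V^{M,π}(s₀) = ∑_{t≥0} γ^t E[R(s_t, π(s_t))]`. -/
noncomputable def V (M : MDP S A) (π : S → A) (s₀ : S) : ℝ :=
  ∑' t : ℕ, M.γ ^ t * ∑ s : S, ((M.stateDist π s₀ t) s).toReal * M.R s (π s)

/-- A policy `ρ` is optimal for `M` if it dominates every policy at every state. -/
def Optimal (M : MDP S A) (ρ : S → A) : Prop :=
  ∀ (ρ' : S → A) (s : S), M.V ρ' s ≤ M.V ρ s

end MDP

section MMDP

variable {S : Type} [Fintype S] [Nonempty S]
variable {n : ℕ} {A : Fin n → Type} [∀ i, Fintype (A i)] [∀ i, Nonempty (A i)]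

/-- A joint policy `(π₁,…,π_n)` regarded as a single policy over joint actions. -/
def toPolicy (π : ∀ i, S → A i) : S → ∀ i, A i := fun s i => π i s

/-- The `i`-th self-absorbed projection `Π_i(M, π_{-i})`: the single agent MDP for
agent `i` when the other agents act according to `π_{-i}`. -/
noncomputable def proj (M : MDP S (∀ i, A i)) (i : Fin n) (π : ∀ j, S → A j) :
    MDP S (A i) where
  T := fun s a => M.T s (Function.update (fun j => π j s) i a)
  R := fun s a => M.R s (Function.update (fun j => π j s) i a)
  γ := M.γ
  γ_nonneg := M.γ_nonneg
  γ_lt_one := M.γ_lt_one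

/-- Given that each projection has a unique optimal policy, the `i`-th best
response operator replaces agent `i`'s policy by the optimal policy of
`Π_i(M, π_{-i})`. -/
noncomputable def BR (M : MDP S (∀ i, A i))
    (hU : ∀ (i : Fin n) (π : ∀ j, S → A j), ∃! ρ : S → A i, (proj M i π).Optimal ρ)
    (i : Fin n) (π : ∀ j, S → A j) : ∀ j, S → A j :=
  Function.update π i (hU i π).choose

/-- A joint policy `π` is a Nash equilibrium if no unilateral deviation of a single
agent can increase the value at any state. -/
def Nash (M : MDP S (∀ i, A i)) (π : ∀ j, S → A j) : Prop :=
  ∀ (i : Fin n) (π' : S → A i) (s : S),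
    M.V (toPolicy (Function.update π i π')) s ≤ M.V (toPolicy π) s

/-- The joint response operator `JR_σ = BR_{σ(n)} ∘ ⋯ ∘ BR_{σ(1)}`. -/
noncomputable def JR (M : MDP S (∀ i, A i))
    (hU : ∀ (i : Fin n) (π : ∀ j, S → A j), ∃! ρ : S → A i, (proj M i π).Optimal ρ)
    (σ : Equiv.Perm (Fin n)) (π : ∀ j, S → A j) : ∀ j, S → A j :=
  (List.finRange n).foldl (fun p k => BR M hU (σ k) p) π

end MMDP

theorem toPolicy_update {S : Type} {n : ℕ} {A : Fin n → Type} (π : ∀ j, S → A j) (i : Fin n)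
    (ρ : S → A i) (s : S) :
    toPolicy (Function.update π i ρ) s = Function.update (fun j => π j s) i (ρ s) := by
  funext j
  rcases eq_or_ne j i with rfl | h
  · simp [toPolicy]
  · simp [toPolicy, h]

section BestResponse

variable {S : Type} [Fintype S] [Nonempty S]
variable {n : ℕ} {A : Fin n → Type} [∀ i, Fintype (A i)] [∀ i, Nonempty (A i)]

theorem stateDist_proj (M : MDP S (∀ i, A i)) (i : Fin n) (π : ∀ j, S → A j) (ρ : S → A i)
    (s₀ : S) (t : ℕ) :
    (proj M i π).stateDist ρ s₀ t = M.stateDist (toPolicy (Function.update π i ρ)) s₀ t := by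
  induction t with
  | zero => rfl
  | succ t ih =>
    simp only [MDP.stateDist, ih, toPolicy_update]
    rfl

/-- The value of a policy in a projection is the value of the corresponding joint policy. -/
theorem V_proj (M : MDP S (∀ i, A i)) (i : Fin n) (π : ∀ j, S → A j) (ρ : S → A i) (s : S) :
    (proj M i π).V ρ s = M.V (toPolicy (Function.update π i ρ)) s := by
  simp only [MDP.V, stateDist_proj, toPolicy_update]
  rfl

variable (M : MDP S (∀ i, A i))
  (hU : ∀ (i : Fin n) (π : ∀ j, S → A j), ∃! ρ : S → A i, (proj M i π).Optimal ρ)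

/-- No deviation of agent `i` from `π` beats the best response. -/
theorem V_update_le_V_BR (i : Fin n) (π : ∀ j, S → A j) (ρ : S → A i) (s : S) :
    M.V (toPolicy (Function.update π i ρ)) s ≤ M.V (toPolicy (BR M hU i π)) s := by
  have h := (hU i π).choose_spec.1 ρ s
  rwa [V_proj, V_proj] at h

theorem V_le_V_BR (i : Fin n) (π : ∀ j, S → A j) (s : S) :
    M.V (toPolicy π) s ≤ M.V (toPolicy (BR M hU i π)) s := by
  simpa using V_update_le_V_BR M hU i π (π i) s

/-- A joint policy that a best response does not improve is fixed by that best response. -/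
theorem BR_eq_self_of_V_le (i : Fin n) (π : ∀ j, S → A j)
    (h : ∀ s, M.V (toPolicy (BR M hU i π)) s ≤ M.V (toPolicy π) s) : BR M hU i π = π := by
  have hopt : (proj M i π).Optimal (π i) := fun ρ s => by
    rw [V_proj, V_proj, Function.update_eq_self]
    exact (V_update_le_V_BR M hU i π ρ s).trans (h s)
  have hi : π i = (hU i π).choose := (hU i π).choose_spec.2 _ hopt
  rw [BR, ← hi, Function.update_eq_self]

theorem nash_of_forall_BR_eq_self (π : ∀ j, S → A j) (h : ∀ i, BR M hU i π = π) :
    Nash M π := fun i ρ s => by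
  simpa only [h i] using V_update_le_V_BR M hU i π ρ s

end BestResponse

/-- Theorem 1, exact best-response form: the round-robin best
response sequence `π^g := BR_{(g mod n)+1}(π^{g-1})` has non-decreasing values and
converges in finite time to a Nash equilibrium. (Agents `1,…,n` are represented by
`Fin n`, the 1-indexed agent `(g mod n)+1` being the index `g % n : Fin n`.) -/
theorem round_robin_BR_converges_to_nash
    {S : Type} [Fintype S] [Nonempty S] {n : ℕ} {A : Fin n → Type}
    [∀ i, Fintype (A i)] [∀ i, Nonempty (A i)] (hn : 0 < n)
    (M : MDP S (∀ i, A i))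
    (hU : ∀ (i : Fin n) (π : ∀ j, S → A j), ∃! ρ : S → A i, (proj M i π).Optimal ρ)
    (πseq : ℕ → ∀ j, S → A j)
    (hrec : ∀ g : ℕ,
      πseq (g + 1) = BR M hU ⟨(g + 1) % n, Nat.mod_lt _ hn⟩ (πseq g)) :
    (∀ s : S, Monotone fun g : ℕ => M.V (toPolicy (πseq g)) s) ∧
    ∃ N : ℕ, (∀ g : ℕ, N ≤ g → πseq g = πseq N) ∧ Nash M (πseq N) := by
  have hmono : ∀ s : S, Monotone fun g : ℕ => M.V (toPolicy (πseq g)) s := fun s =>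
    monotone_nat_of_le_succ fun g => by
      rw [hrec g]
      exact V_le_V_BR M hU _ _ s
  refine ⟨hmono, ?_⟩
  obtain ⟨p, hp⟩ := Finite.exists_infinite_fiber πseq
  have hp' : (πseq ⁻¹' {p}).Infinite := Set.infinite_coe_iff.mp hp
  obtain ⟨N, hN⟩ := hp'.nonempty
  have hstep : ∀ g, N ≤ g → πseq (g + 1) = πseq g := fun g hg => by
    obtain ⟨k, hk, hgk⟩ := hp'.exists_gt g
    rw [hrec g]
    refine BR_eq_self_of_V_le M hU _ _ fun s => ?_
    have hk' : πseq k = πseq N := hk.trans hN.symm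
    have h₁ := hmono s (Nat.succ_le_of_lt hgk)
    have h₂ := hmono s hg
    simp only [Nat.succ_eq_add_one, hrec g, hk'] at h₁ h₂
    exact h₁.trans h₂
  have hconst : ∀ g, N ≤ g → πseq g = πseq N := fun g hg => by
    induction g, hg using Nat.le_induction with
    | base => rfl
    | succ g hg ih => rw [hstep g hg, ih]
  refine ⟨N, hconst, nash_of_forall_BR_eq_self M hU _ fun i => ?_⟩
  obtain ⟨g, hg, hgi⟩ : ∃ g, N ≤ g ∧ (g + 1) % n = i := by
    have hle : N + 1 ≤ n * (N + 1) := Nat.le_mul_of_pos_left _ hn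
    refine ⟨i + n * (N + 1) - 1, by omega, ?_⟩
    rw [Nat.sub_add_cancel (by omega), Nat.add_mul_mod_self_left, Nat.mod_eq_of_lt i.isLt]
  have h := hrec g
  rw [hconst g hg, hconst (g + 1) (by omega),
    show (⟨(g + 1) % n, Nat.mod_lt _ hn⟩ : Fin n) = i from Fin.ext hgi] at h
  exact h.symm
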